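/- Let c ∈ 𝕋 and let μ be a g-measure for g^c. Let n ∈ ℕ and let I ⊂ 𝕋 be an interval (arc) of length at most 2^{−n} such that, if its length equals exactly 2^{−n}, at least one of its two boundary points is not contained in I. Then T^n restricted to I is a bijection onto T^n I, and, denoting its inverse by T_I^{−n}, one has μ(I) = ∫_{T^n I} exp(ψ^c_n(T_I^{−n} x)) dμ(x). Consequently, log μ(T^n I) + inf_{x∈I} ψ^c_n(x) ≤ log μ(I) ≤ log μ(T^n I) + sup_{x∈I} ψ^c_n(x), as inequalities in ℝ ∪ {−∞}. -/

import Mathlib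

open MeasureTheory Filter Topology Set
open scoped ENNReal

noncomputable section

namespace GTM

abbrev Torus := AddCircle (1 : ℝ)

instance : Fact ((0:ℝ) < 1) := ⟨one_pos⟩

/-- The doubling map on the torus. -/
def dbl (x : Torus) : Torus := x + x

/-- The function `x ↦ |cos (π x)|` lifted to the torus. -/
def absCos : Torus → ℝ :=
  Function.Periodic.lift (f := fun x : ℝ => |Real.cos (Real.pi * x)|)
    (by
      intro x
      simp [mul_add, mul_one, Real.cos_add_pi, abs_neg])

/-- The potential `ψ^c(x) = 2 log |cos (π (x - c))|`, with value `⊥ = -∞` at the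
singularity `c + 1/2`. -/
def psi (c : Torus) (x : Torus) : EReal :=
  if absCos (x - c) = 0 then ⊥ else ((2 * Real.log (absCos (x - c)) : ℝ) : EReal)

/-- The Birkhoff sums `ψ^c_n` of the potential `ψ^c` under the doubling map. -/
def psiSum (c : Torus) (n : ℕ) (x : Torus) : EReal :=
  ∑ k ∈ Finset.range n, psi c (dbl^[k] x)

/-- The left endpoint of the dyadic cylinder interval of a binary word. -/
def wordVal (n : ℕ) (ω : Fin n → Bool) : ℝ :=
  ∑ i : Fin n, (if ω i then (1 : ℝ) else 0) / 2 ^ ((i : ℕ) + 1)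

/-- The closed dyadic interval `⟨ω⟩ ⊆ 𝕋` associated to a binary word `ω`. -/
def cyl (n : ℕ) (ω : Fin n → Bool) : Set Torus :=
  (fun x : ℝ => (x : Torus)) '' Set.Icc (wordVal n ω) (wordVal n ω + 1 / 2 ^ n)

/-- The exponential function on extended reals, `exp ⊥ = 0`, `exp ⊤ = ∞`. -/
def eexp (x : EReal) : ℝ≥0∞ :=
  if x = ⊥ then 0 else if x = ⊤ then ⊤ else ENNReal.ofReal (Real.exp x.toReal)

/-- The logarithm on `ℝ≥0∞`, `log 0 = ⊥`, `log ∞ = ⊤`. -/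
def elog (x : ℝ≥0∞) : EReal :=
  if x = 0 then ⊥ else if x = ⊤ then ⊤ else ((Real.log x.toReal : ℝ) : EReal)

/-- The partition function `Σ_{ω ∈ {0,1}ⁿ} exp (t · sup_{x ∈ ⟨ω⟩} ψ^c_n(x))`. -/
def presZ (c : Torus) (t : ℝ) (n : ℕ) : ℝ≥0∞ :=
  ∑ ω : Fin n → Bool, eexp ((t : EReal) * ⨆ x ∈ cyl n ω, psiSum c n x)

/-- The upper topological pressure `P̄_top(t ψ^c)`. -/
def presUpper (c : Torus) (t : ℝ) : EReal :=
  atTop.limsup fun n : ℕ => (((n : ℝ)⁻¹ : ℝ) : EReal) * elog (presZ c t n)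

/-- The lower topological pressure `P̲_top(t ψ^c)`. -/
def presLower (c : Torus) (t : ℝ) : EReal :=
  atTop.liminf fun n : ℕ => (((n : ℝ)⁻¹ : ℝ) : EReal) * elog (presZ c t n)

/-- The `g`-function `g^c(x) = cos² (π (x - c))`. -/
def gfun (c : Torus) (x : Torus) : ℝ := (absCos (x - c)) ^ 2

/-- The halving map `x ↦ x/2` on the torus, computed on the representative in `[0,1)`. -/
def half (x : Torus) : Torus := (((AddCircle.equivIco 1 0 x : ℝ) / 2 : ℝ) : Torus)

/-- `μ` is a `g`-measure for `g^c`: it is a Borel probability measure invariant under the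
dual transfer operator of `g^c`. -/
def IsGMeasure (c : Torus) (μ : Measure Torus) : Prop :=
  IsProbabilityMeasure μ ∧
    ∀ f : C(Torus, ℝ),
      ∫ x, f x ∂μ =
        ∫ x,
          (gfun c (half x) * f (half x) +
            gfun c (half x + (((1 : ℝ) / 2 : ℝ) : Torus)) *
              f (half x + (((1 : ℝ) / 2 : ℝ) : Torus))) ∂μ

lemma eexp_eq_exp (x : EReal) : eexp x = EReal.exp x := by
  induction x <;> simp [eexp]

lemma elog_eq_log (x : ℝ≥0∞) : elog x = ENNReal.log x := rfl

lemma absCos_coe (x : ℝ) : absCos (x : Torus) = |Real.cos (Real.pi * x)| := rfl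

lemma absCos_nonneg (x : Torus) : 0 ≤ absCos x := by
  induction x using QuotientAddGroup.induction_on with
  | H x => exact abs_nonneg _

lemma absCos_le_one (x : Torus) : absCos x ≤ 1 := by
  induction x using QuotientAddGroup.induction_on with
  | H x => exact Real.abs_cos_le_one _

lemma continuous_absCos : Continuous absCos :=
  continuous_coinduced_dom.mpr
    (show Continuous fun x : ℝ => |Real.cos (Real.pi * x)| by fun_prop)

lemma continuous_gfun (c : Torus) : Continuous (gfun c) :=
  (continuous_absCos.comp (continuous_sub_right c)).pow 2

lemma gfun_nonneg (c x : Torus) : 0 ≤ gfun c x := sq_nonneg _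

lemma gfun_le_one (c x : Torus) : gfun c x ≤ 1 :=
  pow_le_one₀ (absCos_nonneg _) (absCos_le_one _)

lemma exp_psi (c x : Torus) : EReal.exp (psi c x) = ENNReal.ofReal (gfun c x) := by
  unfold psi gfun
  split_ifs with h
  · simp [h]
  · have h0 : 0 < absCos (x - c) := lt_of_le_of_ne (absCos_nonneg _) (Ne.symm h)
    rw [EReal.exp_coe, two_mul, Real.exp_add, Real.exp_log h0, sq]

lemma exp_psiSum_succ (c : Torus) (n : ℕ) (x : Torus) :
    EReal.exp (psiSum c (n + 1) x) =
      ENNReal.ofReal (gfun c (dbl^[n] x)) * EReal.exp (psiSum c n x) := by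
  rw [psiSum, Finset.sum_range_succ, EReal.exp_add, exp_psi, mul_comm, psiSum]

lemma measurable_half : Measurable half :=
  AddCircle.measurable_mk'.comp
    ((measurable_subtype_coe.comp (AddCircle.measurableEquivIco 1 0).measurable).div_const 2)

lemma coe_half_add_coe_half : (((1 : ℝ) / 2 : ℝ) : Torus) + (((1 : ℝ) / 2 : ℝ) : Torus) = 0 := by
  rw [← AddCircle.coe_add, add_halves]
  exact AddCircle.coe_period 1

lemma dbl_half (x : Torus) : dbl (half x) = x := by
  rw [dbl, half, ← AddCircle.coe_add, add_halves]
  exact AddCircle.coe_equivIco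

lemma dbl_half_add (x : Torus) : dbl (half x + (((1 : ℝ) / 2 : ℝ) : Torus)) = x := by
  have h := dbl_half x
  unfold dbl at h ⊢
  rw [add_add_add_comm, h, coe_half_add_coe_half, add_zero]

lemma coe_half_ne_zero : (((1 : ℝ) / 2 : ℝ) : Torus) ≠ 0 := by
  rw [Ne, AddCircle.coe_eq_zero_iff_of_mem_Ico (by constructor <;> norm_num)]
  norm_num

lemma eq_half_or_of_dbl_eq {x y : Torus} (h : dbl y = x) :
    y = half x ∨ y = half x + (((1 : ℝ) / 2 : ℝ) : Torus) := by
  subst h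
  have h2 : (2 : ℕ) • (y - half (dbl y)) = 0 := by
    rw [smul_sub, two_nsmul, two_nsmul]
    exact sub_eq_zero.mpr (dbl_half (dbl y)).symm
  obtain ⟨r, hr⟩ := QuotientAddGroup.mk_surjective (y - half (dbl y))
  rw [← hr] at h2
  have h3 : ((2 * r : ℝ) : Torus) = 0 := by
    rw [← h2, two_nsmul, two_mul]; rfl
  obtain ⟨m, hm⟩ := (AddCircle.coe_eq_zero_iff 1).mp h3
  rw [zsmul_one] at hm
  rcases Int.even_or_odd' m with ⟨k, rfl | rfl⟩
  · left
    have : r = k := by push_cast at hm; linarith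
    have h4 : ((r : ℝ) : Torus) = 0 := (AddCircle.coe_eq_zero_iff 1).mpr ⟨k, by simp [this]⟩
    exact sub_eq_zero.mp (hr.symm.trans h4)
  · right
    have : r = k + 1 / 2 := by push_cast at hm; linarith
    have h4 : ((k : ℝ) : Torus) = 0 := (AddCircle.coe_eq_zero_iff 1).mpr ⟨k, by simp⟩
    have h5 : ((r : ℝ) : Torus) = (((1 : ℝ) / 2 : ℝ) : Torus) := by
      rw [this, AddCircle.coe_add, h4, zero_add]
    exact eq_add_of_sub_eq' (hr.symm.trans h5)

/-- The transfer operator of `g^c` acting on `[0, ∞]`-valued functions. -/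
def transfer (c : Torus) (h : Torus → ℝ≥0∞) (x : Torus) : ℝ≥0∞ :=
  ENNReal.ofReal (gfun c (half x)) * h (half x) +
    ENNReal.ofReal (gfun c (half x + (((1 : ℝ) / 2 : ℝ) : Torus))) *
      h (half x + (((1 : ℝ) / 2 : ℝ) : Torus))

lemma measurable_transfer (c : Torus) {h : Torus → ℝ≥0∞} (hh : Measurable h) :
    Measurable (transfer c h) := by
  have hg := (continuous_gfun c).measurable
  have h1 := measurable_half
  have h2 := measurable_half.add_const (((1 : ℝ) / 2 : ℝ) : Torus)
  exact ((hg.comp h1).ennreal_ofReal.mul (hh.comp h1)).add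
    ((hg.comp h2).ennreal_ofReal.mul (hh.comp h2))

/-- The image of a measure under the dual transfer operator of `g^c`. -/
def dualTransfer (c : Torus) (μ : Measure Torus) : Measure Torus :=
  (μ.withDensity fun x => ENNReal.ofReal (gfun c (half x))).map half +
    (μ.withDensity fun x =>
      ENNReal.ofReal (gfun c (half x + (((1 : ℝ) / 2 : ℝ) : Torus)))).map
      fun x => half x + (((1 : ℝ) / 2 : ℝ) : Torus)

lemma lintegral_dualTransfer (c : Torus) (μ : Measure Torus) {h : Torus → ℝ≥0∞}
    (hh : Measurable h) : ∫⁻ x, h x ∂(dualTransfer c μ) = ∫⁻ x, transfer c h x ∂μ := by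
  have hg := (continuous_gfun c).measurable
  have h1 := measurable_half
  have h2 := measurable_half.add_const (((1 : ℝ) / 2 : ℝ) : Torus)
  rw [dualTransfer, lintegral_add_measure, lintegral_map hh h1, lintegral_map hh h2]
  refine (congrArg₂ (· + ·)
    (lintegral_withDensity_eq_lintegral_mul _ (hg.comp h1).ennreal_ofReal (hh.comp h1))
    (lintegral_withDensity_eq_lintegral_mul _ (hg.comp h2).ennreal_ofReal (hh.comp h2))).trans ?_
  exact (lintegral_add_left ((hg.comp h1).ennreal_ofReal.mul (hh.comp h1)) _).symm

lemma IsGMeasure.dualTransfer_eq {c : Torus} {μ : Measure Torus} (hμ : IsGMeasure c μ) :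
    μ = dualTransfer c μ := by
  have := hμ.1
  refine ext_of_forall_lintegral_eq_of_IsFiniteMeasure fun f => ?_
  rw [lintegral_dualTransfer c μ f.continuous.measurable.coe_nnreal_ennreal]
  have hf : Continuous fun x => (f x : ℝ) := NNReal.continuous_coe.comp f.continuous
  obtain ⟨C, hC⟩ := f.isBounded_range.bddAbove
  have hfC (x : Torus) : (f x : ℝ) ≤ C := hC (mem_range_self x)
  have h1 := measurable_half
  have h2 := measurable_half.add_const (((1 : ℝ) / 2 : ℝ) : Torus)
  have hgf : Measurable fun x => gfun c x * (f x : ℝ) :=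
    ((continuous_gfun c).mul hf).measurable
  have hgf_nonneg (x : Torus) : 0 ≤ gfun c x * (f x : ℝ) :=
    mul_nonneg (gfun_nonneg c x) (f x).coe_nonneg
  have hgf_le (x : Torus) : gfun c x * (f x : ℝ) ≤ C :=
    (mul_le_of_le_one_left (f x).coe_nonneg (gfun_le_one c x)).trans (hfC x)
  have key := congrArg ENNReal.ofReal (hμ.2 ⟨fun x => (f x : ℝ), hf⟩)
  simp only [ContinuousMap.coe_mk] at key
  rw [ofReal_integral_eq_lintegral_ofReal
      (.of_bound hf.aestronglyMeasurable (C : ℝ) (.of_forall fun x => by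
        rw [Real.norm_of_nonneg (f x).coe_nonneg]; exact hfC x))
      (.of_forall fun x => (f x).coe_nonneg),
    ofReal_integral_eq_lintegral_ofReal
      (f := fun x => gfun c (half x) * (f (half x) : ℝ) +
        gfun c (half x + (((1 : ℝ) / 2 : ℝ) : Torus)) *
          (f (half x + (((1 : ℝ) / 2 : ℝ) : Torus)) : ℝ))
      (.of_bound ((hgf.comp h1).add (hgf.comp h2)).aestronglyMeasurable (C + C : ℝ)
        (.of_forall fun x => by
          rw [Real.norm_of_nonneg (add_nonneg (hgf_nonneg _) (hgf_nonneg _))]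
          exact add_le_add (hgf_le _) (hgf_le _)))
      (.of_forall fun x => add_nonneg (hgf_nonneg _) (hgf_nonneg _))] at key
  simp only [ENNReal.ofReal_coe_nnreal] at key
  rw [key]
  refine lintegral_congr fun x => ?_
  rw [ENNReal.ofReal_add (hgf_nonneg _) (hgf_nonneg _), ENNReal.ofReal_mul (gfun_nonneg _ _),
    ENNReal.ofReal_mul (gfun_nonneg _ _), ENNReal.ofReal_coe_nnreal, ENNReal.ofReal_coe_nnreal,
    transfer]

lemma IsGMeasure.lintegral_transfer {c : Torus} {μ : Measure Torus} (hμ : IsGMeasure c μ)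
    {h : Torus → ℝ≥0∞} (hh : Measurable h) : ∫⁻ x, transfer c h x ∂μ = ∫⁻ x, h x ∂μ := by
  rw [← lintegral_dualTransfer c μ hh, ← hμ.dualTransfer_eq]

lemma IsGMeasure.lintegral_iterate_transfer {c : Torus} {μ : Measure Torus}
    (hμ : IsGMeasure c μ) (n : ℕ) {h : Torus → ℝ≥0∞} (hh : Measurable h) :
    Measurable ((transfer c)^[n] h) ∧ ∫⁻ x, (transfer c)^[n] h x ∂μ = ∫⁻ x, h x ∂μ := by
  induction n with
  | zero => exact ⟨hh, rfl⟩
  | succ n ih =>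
    rw [Function.iterate_succ_apply']
    exact ⟨measurable_transfer c ih.1, (hμ.lintegral_transfer ih.1).trans ih.2⟩

lemma transfer_apply_of_dbl_eq (c : Torus) {h : Torus → ℝ≥0∞} {x y : Torus} (hy : dbl y = x)
    (h0 : ∀ z, dbl z = x → z ≠ y → h z = 0) :
    transfer c h x = ENNReal.ofReal (gfun c y) * h y := by
  have hne : half x ≠ half x + (((1 : ℝ) / 2 : ℝ) : Torus) := fun h =>
    coe_half_ne_zero (left_eq_add.mp h)
  rcases eq_half_or_of_dbl_eq hy with rfl | rfl
  · rw [transfer, h0 _ (dbl_half_add x) hne.symm, mul_zero, add_zero]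
  · rw [transfer, h0 _ (dbl_half x) hne, mul_zero, zero_add]

lemma iterate_transfer_indicator (c : Torus) (n : ℕ) {I : Set Torus}
    (hI : Set.InjOn (dbl^[n]) I) :
    (∀ x ∉ dbl^[n] '' I, (transfer c)^[n] (I.indicator 1) x = 0) ∧
      ∀ y ∈ I, (transfer c)^[n] (I.indicator 1) (dbl^[n] y) = EReal.exp (psiSum c n y) := by
  induction n with
  | zero =>
    refine ⟨fun x hx => ?_, fun y hy => ?_⟩
    · simp_all
    · simp_all [psiSum]
  | succ n ih =>
    rw [Function.iterate_succ'] at hI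
    obtain ⟨ih0, ih1⟩ := ih hI.of_comp
    rw [Function.iterate_succ', Function.iterate_succ']
    simp only [Function.comp_apply]
    refine ⟨fun x hx => ?_, fun y hy => ?_⟩
    · have hz (z : Torus) (hz : dbl z = x) : (transfer c)^[n] (I.indicator 1) z = 0 := by
        refine ih0 z fun hzI => hx ?_
        obtain ⟨w, hw, rfl⟩ := hzI
        exact ⟨w, hw, hz⟩
      rw [transfer, hz _ (dbl_half x), hz _ (dbl_half_add x), mul_zero, mul_zero, add_zero]
    · rw [transfer_apply_of_dbl_eq c rfl, ih1 y hy, exp_psiSum_succ]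
      intro z hz hzy
      refine ih0 z ?_
      rintro ⟨w, hw, rfl⟩
      exact hzy (congrArg _ (hI hw hy hz))

lemma IsGMeasure.measure_eq_setLIntegral {c : Torus} {μ : Measure Torus} (hμ : IsGMeasure c μ)
    (n : ℕ) {I : Set Torus} (hI : Set.InjOn (dbl^[n]) I) (hIm : MeasurableSet I)
    (hIm' : MeasurableSet (dbl^[n] '' I)) {F : Torus → Torus}
    (hF : ∀ x ∈ I, F (dbl^[n] x) = x) :
    μ I = ∫⁻ y in dbl^[n] '' I, EReal.exp (psiSum c n (F y)) ∂μ := by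
  obtain ⟨h0, h1⟩ := iterate_transfer_indicator c n hI
  rw [← lintegral_indicator_one hIm,
    ← (hμ.lintegral_iterate_transfer n (measurable_one.indicator hIm)).2,
    ← lintegral_indicator hIm']
  refine lintegral_congr fun x => ?_
  by_cases hx : x ∈ dbl^[n] '' I
  · rw [indicator_of_mem hx]
    obtain ⟨y, hy, rfl⟩ := hx
    rw [h1 y hy, hF y hy]
  · rw [indicator_of_notMem hx, h0 x hx]

lemma dbl_iterate_coe (n : ℕ) (x : ℝ) : dbl^[n] (x : Torus) = ((2 ^ n * x : ℝ) : Torus) := by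
  induction n with
  | zero => simp
  | succ n ih =>
    rw [Function.iterate_succ_apply', ih, dbl, ← AddCircle.coe_add]
    ring_nf

lemma measurableSet_image_coe {J : Set ℝ} {a b : ℝ} (hJ1 : Ioo a b ⊆ J) (hJ2 : J ⊆ Icc a b) :
    MeasurableSet ((fun x : ℝ => (x : Torus)) '' J) := by
  have hJ : J = Ioo a b ∪ J ∩ {a, b} := by
    ext x
    refine ⟨fun hx => ?_, ?_⟩
    · have := hJ2 hx
      by_cases hxa : x = a
      · exact .inr ⟨hx, .inl hxa⟩
      by_cases hxb : x = b
      · exact .inr ⟨hx, .inr hxb⟩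
      exact .inl ⟨lt_of_le_of_ne this.1 (Ne.symm hxa), lt_of_le_of_ne this.2 hxb⟩
    · rintro (hx | hx)
      exacts [hJ1 hx, hx.1]
  rw [hJ, image_union]
  exact (QuotientAddGroup.isOpenMap_coe _ isOpen_Ioo).measurableSet.union
    (((toFinite {a, b}).inter_of_right J).image _).measurableSet

lemma injOn_dbl_iterate {n : ℕ} {J : Set ℝ} {a b : ℝ} (hJ : J ⊆ Icc a b)
    (hlen : b - a ≤ 1 / 2 ^ n) (hbd : b - a = 1 / 2 ^ n → a ∉ J ∨ b ∉ J) :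
    Set.InjOn (dbl^[n]) ((fun x : ℝ => (x : Torus)) '' J) := by
  have h2 : (0 : ℝ) < 2 ^ n := by positivity
  have hlen' : 2 ^ n * (b - a) ≤ 1 := by rwa [le_div_iff₀' h2] at hlen
  have hlt {x y : ℝ} (hx : x ∈ J) (hy : y ∈ J) : 2 ^ n * x - 2 ^ n * y < 1 := by
    have hxb := (hJ hx).2
    have hya := (hJ hy).1
    by_contra! h
    have h3 : 2 ^ n * (b - x) + 2 ^ n * (y - a) ≤ 0 := by linarith
    have h4 : 0 ≤ 2 ^ n * (b - x) := mul_nonneg h2.le (by linarith)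
    have h5 : 0 ≤ 2 ^ n * (y - a) := mul_nonneg h2.le (by linarith)
    have hxb' : x = b := by
      have := (mul_eq_zero_iff_left h2.ne').mp (show 2 ^ n * (b - x) = 0 by linarith)
      linarith
    have hya' : y = a := by
      have := (mul_eq_zero_iff_left h2.ne').mp (show 2 ^ n * (y - a) = 0 by linarith)
      linarith
    subst hxb' hya'
    rcases hbd (by rw [eq_div_iff h2.ne']; linarith) with h | h
    exacts [h hy, h hx]
  rintro _ ⟨x, hx, rfl⟩ _ ⟨y, hy, rfl⟩ hxy
  simp only [dbl_iterate_coe] at hxy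
  rw [← sub_eq_zero, ← AddCircle.coe_sub, AddCircle.coe_eq_zero_iff] at hxy
  obtain ⟨m, hm⟩ := hxy
  rw [zsmul_one] at hm
  have hm1 : m < 1 := by exact_mod_cast hm.trans_lt (hlt hx hy)
  have hm2 : -1 < m := by
    have : (-1 : ℝ) < m := by linarith [hlt hy hx]
    exact_mod_cast this
  obtain rfl : m = 0 := by omega
  have : x = y := mul_left_cancel₀ h2.ne' (by push_cast at hm; linarith)
  rw [this]

/-- for a `g`-measure `μ` for `g^c` and an interval `I ⊆ 𝕋` of length at
most `2^{−n}` (not closed if the length is exactly `2^{−n}`), the map `T^n` is a bijection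
from `I` onto `T^n I`, `μ(I) = ∫_{T^n I} exp(ψ^c_n(T_I^{−n} x)) dμ(x)` for (any 'inverse'
`T_I^{−n}` of `T^n|_I`), and consequently
`log μ(T^n I) + inf_I ψ^c_n ≤ log μ(I) ≤ log μ(T^n I) + sup_I ψ^c_n`. -/
theorem stmt14 (c : Torus) (μ : Measure Torus) (hμ : IsGMeasure c μ) (n : ℕ) (hn : 1 ≤ n)
    (J : Set ℝ) (a b : ℝ) (hJ1 : Set.Ioo a b ⊆ J) (hJ2 : J ⊆ Set.Icc a b)
    (hlen : b - a ≤ 1 / 2 ^ n) (hbd : b - a = 1 / 2 ^ n → a ∉ J ∨ b ∉ J)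
    (I : Set Torus) (hI : I = (fun x : ℝ => (x : Torus)) '' J) :
    Set.BijOn (dbl^[n]) I (dbl^[n] '' I) ∧
      (∀ F : Torus → Torus, (∀ x ∈ I, F (dbl^[n] x) = x) →
        μ I = ∫⁻ y in dbl^[n] '' I, eexp (psiSum c n (F y)) ∂μ) ∧
      elog (μ (dbl^[n] '' I)) + (⨅ x ∈ I, psiSum c n x) ≤ elog (μ I) ∧
      elog (μ I) ≤ elog (μ (dbl^[n] '' I)) + (⨆ x ∈ I, psiSum c n x) := by
  subst hI
  have hinj := injOn_dbl_iterate hJ2 hlen hbd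
  have hIm := measurableSet_image_coe hJ1 hJ2
  have hIm' : MeasurableSet (dbl^[n] '' ((fun x : ℝ => (x : Torus)) '' J)) := by
    have h2 : (0 : ℝ) < 2 ^ n := by positivity
    have himage : dbl^[n] '' ((fun x : ℝ => (x : Torus)) '' J) =
        (fun x : ℝ => (x : Torus)) '' ((fun x => 2 ^ n * x) '' J) := by
      simp only [image_image, dbl_iterate_coe]
    rw [himage]
    refine measurableSet_image_coe (a := 2 ^ n * a) (b := 2 ^ n * b) ?_ ?_
    · rw [← image_mul_left_Ioo h2]
      exact image_mono hJ1
    · rw [← image_mul_left_Icc' h2]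
      exact image_mono hJ2
  set I := (fun x : ℝ => (x : Torus)) '' J
  have hF (F : Torus → Torus) (h : ∀ x ∈ I, F (dbl^[n] x) = x) :=
    hμ.measure_eq_setLIntegral n hinj hIm hIm' h
  have hinv : ∀ x ∈ I, Function.invFunOn (dbl^[n]) I (dbl^[n] x) = x :=
    hinj.leftInvOn_invFunOn
  have hμI := hF _ hinv
  refine ⟨hinj.bijOn_image, fun F h => ?_, ?_, ?_⟩
  · simp only [eexp_eq_exp]
    exact hF F h
  · rw [elog_eq_log, elog_eq_log, ← EReal.log_exp (⨅ x ∈ I, psiSum c n x),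
      ← ENNReal.log_mul_add, ENNReal.log_le_log_iff, hμI, mul_comm, ← setLIntegral_const]
    refine setLIntegral_mono' hIm' ?_
    rintro _ ⟨x, hx, rfl⟩
    rw [hinv x hx]
    exact EReal.exp_monotone (iInf₂_le x hx)
  · rw [elog_eq_log, elog_eq_log, ← EReal.log_exp (⨆ x ∈ I, psiSum c n x),
      ← ENNReal.log_mul_add, ENNReal.log_le_log_iff, hμI, mul_comm, ← setLIntegral_const]
    refine setLIntegral_mono' hIm' ?_
    rintro _ ⟨x, hx, rfl⟩
    rw [hinv x hx]
    exact EReal.exp_monotone (le_iSup₂_of_le x hx le_rfl)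

end GTM
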